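/- arXiv:quant-ph/0209090 — 6 statements merged into one kernel-verified Lean document; each statement's English description precedes it below -/
import Mathlib

section
/- Let H₁, H₂ be complex separable Hilbert spaces, φ₀ a unit vector in H₂, and U : H₁ ⊗ H₂ → H₁ ⊗ H₂ a unitary map such that U(φ ⊗ φ₀) is a product vector for every φ ∈ H₁. Let {φₙ : n ∈ ℕ} be an orthonormal basis of H₁ and write U(φₙ ⊗ φ₀) = ψₙ ⊗ χₙ with unit vectors ψₙ ∈ H₁ and χₙ ∈ H₂. Then either (a) the family {ψₙ} is an orthonormal system in H₁ and every χₙ is a unimodular scalar multiple of χ₁, or (b) the family {χₙ} is an orthonormal system in H₂ and every ψₙ is a unimodular scalar multiple of ψ₁. -/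
open scoped ComplexInnerProductSpace

noncomputable section

/-- `T`, together with the bilinear map `tmul`, is (a copy of) the Hilbert-space
tensor product of the complex inner product spaces `H₁` and `H₂`: the inner
product of simple tensors factorizes, `⟪a ⊗ b, c ⊗ d⟫ = ⟪a, c⟫ ⟪b, d⟫`, and the
simple tensors span a dense subspace. -/
structure IsHilbertTensorProduct
    (H₁ : Type*) (H₂ : Type*) (T : Type*)
    [NormedAddCommGroup H₁] [InnerProductSpace ℂ H₁]
    [NormedAddCommGroup H₂] [InnerProductSpace ℂ H₂]
    [NormedAddCommGroup T] [InnerProductSpace ℂ T]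
    (tmul : H₁ →ₗ[ℂ] H₂ →ₗ[ℂ] T) : Prop where
  inner_tmul : ∀ (a c : H₁) (b d : H₂), ⟪tmul a b, tmul c d⟫ = ⟪a, c⟫ * ⟪b, d⟫
  dense_span :
    Dense (↑(Submodule.span ℂ (Set.range fun p : H₁ × H₂ => tmul p.1 p.2)) : Set T)

/-- Two vectors agree up to a scalar of modulus one. -/
def UnimodularMultiple {E : Type*} [NormedAddCommGroup E] [InnerProductSpace ℂ E]
    (u v : E) : Prop :=
  ∃ c : ℂ, ‖c‖ = 1 ∧ u = c • v

namespace UnimodularMultiple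

variable {E : Type*} [NormedAddCommGroup E] [InnerProductSpace ℂ E] {u v w : E}

theorem refl (u : E) : UnimodularMultiple u u := ⟨1, by simp, by simp⟩

theorem symm (h : UnimodularMultiple u v) : UnimodularMultiple v u := by
  obtain ⟨c, hc, rfl⟩ := h
  have hc0 : c ≠ 0 := norm_ne_zero_iff.mp (by simp [hc])
  exact ⟨c⁻¹, by simp [hc], by rw [smul_smul, inv_mul_cancel₀ hc0, one_smul]⟩

theorem trans (h : UnimodularMultiple u v) (h' : UnimodularMultiple v w) :
    UnimodularMultiple u w := by
  obtain ⟨c, hc, rfl⟩ := h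
  obtain ⟨d, hd, rfl⟩ := h'
  exact ⟨c * d, by simp [hc, hd], smul_smul c d w⟩

theorem inner_ne_zero (h : UnimodularMultiple u v) (hv : v ≠ 0) : ⟪u, v⟫ ≠ 0 := by
  obtain ⟨c, hc, rfl⟩ := h
  have hc0 : c ≠ 0 := norm_ne_zero_iff.mp (by simp [hc])
  rw [inner_smul_left]
  exact mul_ne_zero (by simpa using hc0) (inner_self_ne_zero.mpr hv)

theorem of_smul_unit {y : E} {s t : ℂ} (hu : ‖s • y‖ = 1) (hv : ‖t • y‖ = 1) :
    UnimodularMultiple (s • y) (t • y) := by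
  rw [norm_smul] at hu hv
  have ht : t ≠ 0 := by rintro rfl; simp at hv
  have hy : ‖y‖ ≠ 0 := by intro h; simp [h] at hv
  refine ⟨s / t, ?_, by rw [smul_smul, div_mul_cancel₀ s ht]⟩
  rw [norm_div, mul_right_cancel₀ hy (hu.trans hv.symm), div_self (norm_ne_zero_iff.mpr ht)]

end UnimodularMultiple

/-- If two simple tensors with orthonormal left factors add up to a simple tensor, then their
unit right factors are unimodular multiples of each other. -/
theorem unimodularMultiple_of_tmul_add_tmul_eq
    {E F T : Type*} [NormedAddCommGroup E] [InnerProductSpace ℂ E]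
    [NormedAddCommGroup F] [InnerProductSpace ℂ F]
    [NormedAddCommGroup T] [InnerProductSpace ℂ T] {tmul : E →ₗ[ℂ] F →ₗ[ℂ] T}
    (hinner : ∀ (a c : E) (b d : F), ⟪tmul a b, tmul c d⟫ = ⟪a, c⟫ * ⟪b, d⟫)
    {a c x : E} {b d y : F} (ha : ‖a‖ = 1) (hc : ‖c‖ = 1) (hb : ‖b‖ = 1) (hd : ‖d‖ = 1)
    (hac : ⟪a, c⟫ = 0) (h : tmul a b + tmul c d = tmul x y) :
    UnimodularMultiple b d := by
  have hb' : b = ⟪a, x⟫ • y := by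
    refine ext_inner_left ℂ fun v => ?_
    have := congrArg (fun t => ⟪tmul a v, t⟫) h
    simpa [inner_add_right, hinner, hac, inner_self_eq_norm_sq_to_K, ha, inner_smul_right]
      using this
  have hd' : d = ⟪c, x⟫ • y := by
    refine ext_inner_left ℂ fun v => ?_
    have := congrArg (fun t => ⟪tmul c v, t⟫) h
    simpa [inner_add_right, hinner, inner_eq_zero_symm.mp hac, inner_self_eq_norm_sq_to_K, hc,
      inner_smul_right] using this
  rw [hb'] at hb ⊢
  rw [hd'] at hd ⊢
  exact .of_smul_unit hb hd

/-- Two equivalence relations whose union is total cannot both be proper. -/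
theorem forall_or_forall_of_total_union {ι : Type*} {r s : ι → ι → Prop}
    (hr : Equivalence r) (hs : Equivalence s) (h : ∀ i j, r i j ∨ s i j) :
    (∀ i j, r i j) ∨ ∀ i j, s i j := by
  by_contra! hcon
  obtain ⟨⟨i, j, hij⟩, k, l, hkl⟩ := hcon
  have hsij := (h i j).resolve_left hij
  have key : ∀ m, s m i := by
    intro m
    by_contra hm
    have hmi := (h m i).resolve_right hm
    have hmj := (h m j).resolve_right fun hmj => hm (hs.trans hmj (hs.symm hsij))
    exact hij (hr.trans (hr.symm hmi) hmj)
  exact hkl (hs.trans (key k) (hs.symm (key l)))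

/-- The dichotomy established in the proof of Proposition 1: if a unitary `U` on
`H₁ ⊗ H₂` maps each `φ ⊗ φ₀` to a product vector, and the images of an
orthonormal basis `(φₙ)` of `H₁` are written as `U(φₙ ⊗ φ₀) = ψₙ ⊗ χₙ` with
unit vectors `ψₙ, χₙ`, then either `(ψₙ)` is an orthonormal system and all `χₙ`
are unimodular multiples of `χ₁`, or `(χₙ)` is an orthonormal system and all
`ψₙ` are unimodular multiples of `ψ₁`. -/
theorem orthonormal_basis_image_dichotomy
    {H₁ H₂ T : Type*}
    [NormedAddCommGroup H₁] [InnerProductSpace ℂ H₁] [CompleteSpace H₁]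
    [TopologicalSpace.SeparableSpace H₁]
    [NormedAddCommGroup H₂] [InnerProductSpace ℂ H₂] [CompleteSpace H₂]
    [TopologicalSpace.SeparableSpace H₂]
    [NormedAddCommGroup T] [InnerProductSpace ℂ T] [CompleteSpace T]
    (tmul : H₁ →ₗ[ℂ] H₂ →ₗ[ℂ] T)
    (htp : IsHilbertTensorProduct H₁ H₂ T tmul)
    (φ₀ : H₂) (hφ₀ : ‖φ₀‖ = 1)
    (U : T ≃ₗᵢ[ℂ] T)
    (hU : ∀ φ : H₁, ∃ (x : H₁) (y : H₂), U (tmul φ φ₀) = tmul x y)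
    (b : HilbertBasis ℕ ℂ H₁)
    (ψ : ℕ → H₁) (χ : ℕ → H₂)
    (hψ : ∀ n, ‖ψ n‖ = 1) (hχ : ∀ n, ‖χ n‖ = 1)
    (himg : ∀ n, U (tmul (b n) φ₀) = tmul (ψ n) (χ n)) :
    (Orthonormal ℂ ψ ∧ ∀ n, ∃ c : ℂ, ‖c‖ = 1 ∧ χ n = c • χ 1) ∨
    (Orthonormal ℂ χ ∧ ∀ n, ∃ c : ℂ, ‖c‖ = 1 ∧ ψ n = c • ψ 1) := by
  have hsum (m n : ℕ) : ∃ x y, tmul (ψ m) (χ m) + tmul (ψ n) (χ n) = tmul x y := by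
    obtain ⟨x, y, hxy⟩ := hU (b m + b n)
    exact ⟨x, y, by rw [← hxy, map_add, LinearMap.add_apply, map_add, himg, himg]⟩
  have horth (m n : ℕ) (hmn : m ≠ n) : ⟪ψ m, ψ n⟫ = 0 ∨ ⟪χ m, χ n⟫ = 0 := by
    rw [← mul_eq_zero, ← htp.inner_tmul, ← himg, ← himg, U.inner_map_map, htp.inner_tmul,
      b.orthonormal.inner_eq_zero hmn, zero_mul]
  have hχ_of (m n : ℕ) (h : ⟪ψ m, ψ n⟫ = 0) : UnimodularMultiple (χ m) (χ n) := by
    obtain ⟨x, y, hxy⟩ := hsum m n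
    exact unimodularMultiple_of_tmul_add_tmul_eq htp.inner_tmul (hψ m) (hψ n) (hχ m) (hχ n) h hxy
  have hψ_of (m n : ℕ) (h : ⟪χ m, χ n⟫ = 0) : UnimodularMultiple (ψ m) (ψ n) := by
    obtain ⟨x, y, hxy⟩ := hsum m n
    exact unimodularMultiple_of_tmul_add_tmul_eq (tmul := tmul.flip)
      (fun a c b d => by simp [htp.inner_tmul, mul_comm]) (hχ m) (hχ n) (hψ m) (hψ n) h hxy
  have htotal (m n : ℕ) :
      UnimodularMultiple (χ m) (χ n) ∨ UnimodularMultiple (ψ m) (ψ n) := by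
    rcases eq_or_ne m n with rfl | hmn
    · exact .inl (.refl _)
    · exact (horth m n hmn).imp (hχ_of m n) (hψ_of m n)
  refine (forall_or_forall_of_total_union (r := fun m n => UnimodularMultiple (χ m) (χ n))
    (s := fun m n => UnimodularMultiple (ψ m) (ψ n)) ⟨fun _ => .refl _, .symm, .trans⟩
    ⟨fun _ => .refl _, .symm, .trans⟩ htotal).imp (fun h => ⟨⟨hψ, fun m n hmn => ?_⟩, (h · 1)⟩)
    (fun h => ⟨⟨hχ, fun m n hmn => ?_⟩, (h · 1)⟩)
  · exact (horth m n hmn).resolve_right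
      ((h m n).inner_ne_zero (norm_ne_zero_iff.mp (by simp [hχ])))
  · exact (horth m n hmn).resolve_left
      ((h m n).inner_ne_zero (norm_ne_zero_iff.mp (by simp [hψ])))
end
end

section
/- Let H₁, H₂ be complex Hilbert spaces, φ₀ a unit vector in H₂, and U : H₁ ⊗ H₂ → H₁ ⊗ H₂ a unitary map such that U(φ ⊗ φ₀) is a product vector for every φ ∈ H₁. Let φ₁, φ₂, φ₃ be orthonormal vectors in H₁ and write U(φᵢ ⊗ φ₀) = ψᵢ ⊗ χᵢ with unit vectors ψᵢ ∈ H₁, χᵢ ∈ H₂ for i = 1, 2, 3. If ψ₁ ⊥ ψ₂, then ψ₂ ⊥ ψ₃ and χ₃ is a unimodular scalar multiple of χ₁; it is impossible that χ₂ ⊥ χ₃. -/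
open scoped ComplexInnerProductSpace

noncomputable section

/-- A unit vector whose inner product with another unit vector has modulus one is a unimodular
multiple of it. -/
lemma exists_unimodular_smul_of_inner_mul_inner_eq_one
    {H : Type*} [NormedAddCommGroup H] [InnerProductSpace ℂ H] {a c : H}
    (ha : ‖a‖ = 1) (hc : ‖c‖ = 1) (h : ⟪a, c⟫ * ⟪c, a⟫ = 1) :
    ∃ k : ℂ, ‖k‖ = 1 ∧ c = k • a := by
  have hn : ‖⟪a, c⟫‖ * ‖⟪a, c⟫‖ = 1 := by
    have := congrArg norm h
    rwa [norm_mul, norm_inner_symm c a, norm_one] at this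
  have hn' : ‖⟪a, c⟫‖ = ‖a‖ * ‖c‖ := by
    rw [ha, hc]
    nlinarith [norm_nonneg ⟪a, c⟫]
  obtain ⟨k, -, hk⟩ := (norm_inner_eq_norm_iff (norm_ne_zero_iff.mp (by simp [ha]))
    (norm_ne_zero_iff.mp (by simp [hc]))).mp hn'
  refine ⟨k, ?_, hk⟩
  rw [hk, norm_smul, ha, mul_one] at hc
  exact hc

/-- If a sum of two product vectors with unit factors is a product vector, then the factors on one
of the two sides are unimodular multiples of each other. -/
lemma IsHilbertTensorProduct.exists_unimodular_smul_of_add_eq_tmul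
    {H₁ H₂ T : Type*}
    [NormedAddCommGroup H₁] [InnerProductSpace ℂ H₁]
    [NormedAddCommGroup H₂] [InnerProductSpace ℂ H₂]
    [NormedAddCommGroup T] [InnerProductSpace ℂ T]
    {tmul : H₁ →ₗ[ℂ] H₂ →ₗ[ℂ] T} (htp : IsHilbertTensorProduct H₁ H₂ T tmul)
    {a c x : H₁} {b d y : H₂}
    (ha : ‖a‖ = 1) (hc : ‖c‖ = 1) (hb : ‖b‖ = 1) (hd : ‖d‖ = 1)
    (h : tmul a b + tmul c d = tmul x y) :
    (∃ k : ℂ, ‖k‖ = 1 ∧ c = k • a) ∨ (∃ k : ℂ, ‖k‖ = 1 ∧ d = k • b) := by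
  have key (p : H₁) (q : H₂) : ⟪p, a⟫ * ⟪q, b⟫ + ⟪p, c⟫ * ⟪q, d⟫ = ⟪p, x⟫ * ⟪q, y⟫ := by
    rw [← htp.inner_tmul, ← htp.inner_tmul, ← htp.inner_tmul, ← inner_add_right, h]
  have haa : ⟪a, a⟫ = 1 := by simp [inner_self_eq_norm_sq_to_K, ha]
  have hbb : ⟪b, b⟫ = 1 := by simp [inner_self_eq_norm_sq_to_K, hb]
  have hcc : ⟪c, c⟫ = 1 := by simp [inner_self_eq_norm_sq_to_K, hc]
  have hdd : ⟪d, d⟫ = 1 := by simp [inner_self_eq_norm_sq_to_K, hd]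
  have hdet : (⟪a, c⟫ * ⟪c, a⟫ - 1) * (⟪b, d⟫ * ⟪d, b⟫ - 1) = 0 := by
    have hminor : (⟪a, a⟫ * ⟪b, b⟫ + ⟪a, c⟫ * ⟪b, d⟫) * (⟪c, a⟫ * ⟪d, b⟫ + ⟪c, c⟫ * ⟪d, d⟫) =
        (⟪a, a⟫ * ⟪d, b⟫ + ⟪a, c⟫ * ⟪d, d⟫) * (⟪c, a⟫ * ⟪b, b⟫ + ⟪c, c⟫ * ⟪b, d⟫) := by
      rw [key, key, key, key]
      ring
    rw [haa, hbb, hcc, hdd] at hminor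
    linear_combination hminor
  rcases mul_eq_zero.mp hdet with h0 | h0
  · exact .inl (exists_unimodular_smul_of_inner_mul_inner_eq_one ha hc (sub_eq_zero.mp h0))
  · exact .inr (exists_unimodular_smul_of_inner_mul_inner_eq_one hb hd (sub_eq_zero.mp h0))

/-- The induction step in the proof of Proposition 1: if `U` maps every
`φ ⊗ φ₀` to a product vector, `φ₁, φ₂, φ₃` are orthonormal in `H₁`, the images
are `U(φᵢ ⊗ φ₀) = ψᵢ ⊗ χᵢ` with unit vectors `ψᵢ, χᵢ`, and `ψ₁ ⊥ ψ₂`, then also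
`ψ₂ ⊥ ψ₃` and `χ₃` is a unimodular multiple of `χ₁`; the alternative `χ₂ ⊥ χ₃`
cannot occur. -/
theorem orthogonality_propagates
    {H₁ H₂ T : Type*}
    [NormedAddCommGroup H₁] [InnerProductSpace ℂ H₁]
    [NormedAddCommGroup H₂] [InnerProductSpace ℂ H₂]
    [NormedAddCommGroup T] [InnerProductSpace ℂ T]
    (tmul : H₁ →ₗ[ℂ] H₂ →ₗ[ℂ] T)
    (htp : IsHilbertTensorProduct H₁ H₂ T tmul)
    (φ₀ : H₂) (hφ₀ : ‖φ₀‖ = 1)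
    (U : T ≃ₗᵢ[ℂ] T)
    (hU : ∀ φ : H₁, ∃ (x : H₁) (y : H₂), U (tmul φ φ₀) = tmul x y)
    (φ₁ φ₂ φ₃ : H₁) (hortho : Orthonormal ℂ ![φ₁, φ₂, φ₃])
    (ψ₁ ψ₂ ψ₃ : H₁) (χ₁ χ₂ χ₃ : H₂)
    (hψ₁ : ‖ψ₁‖ = 1) (hψ₂ : ‖ψ₂‖ = 1) (hψ₃ : ‖ψ₃‖ = 1)
    (hχ₁ : ‖χ₁‖ = 1) (hχ₂ : ‖χ₂‖ = 1) (hχ₃ : ‖χ₃‖ = 1)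
    (h₁ : U (tmul φ₁ φ₀) = tmul ψ₁ χ₁)
    (h₂ : U (tmul φ₂ φ₀) = tmul ψ₂ χ₂)
    (h₃ : U (tmul φ₃ φ₀) = tmul ψ₃ χ₃)
    (hperp : ⟪ψ₁, ψ₂⟫ = 0) :
    (⟪ψ₂, ψ₃⟫ = 0 ∧ ∃ c : ℂ, ‖c‖ = 1 ∧ χ₃ = c • χ₁) ∧ ¬ (⟪χ₂, χ₃⟫ = 0) := by
  have dep {α β : H₁} {a c : H₁} {b d : H₂} (ha : ‖a‖ = 1) (hc : ‖c‖ = 1) (hb : ‖b‖ = 1)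
      (hd : ‖d‖ = 1) (hα : U (tmul α φ₀) = tmul a b) (hβ : U (tmul β φ₀) = tmul c d) :
      (∃ k : ℂ, ‖k‖ = 1 ∧ c = k • a) ∨ (∃ k : ℂ, ‖k‖ = 1 ∧ d = k • b) := by
    obtain ⟨x, y, hxy⟩ := hU (α + β)
    refine htp.exists_unimodular_smul_of_add_eq_tmul ha hc hb hd (x := x) (y := y) ?_
    rw [← hxy, ← hα, ← hβ, map_add, LinearMap.add_apply, map_add]
  have orth {α β : H₁} {a c : H₁} {b d : H₂} (hαβ : ⟪α, β⟫ = 0)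
      (hα : U (tmul α φ₀) = tmul a b) (hβ : U (tmul β φ₀) = tmul c d) :
      ⟪a, c⟫ * ⟪b, d⟫ = 0 := by
    rw [← htp.inner_tmul, ← hα, ← hβ, U.inner_map_map, htp.inner_tmul, hαβ, zero_mul]
  have o13 : ⟪φ₁, φ₃⟫ = 0 := hortho.2 (i := 0) (j := 2) (by decide)
  have o23 : ⟪φ₂, φ₃⟫ = 0 := hortho.2 (i := 1) (j := 2) (by decide)
  have ne_zero {k : ℂ} (hk : ‖k‖ = 1) : k ≠ 0 := norm_ne_zero_iff.mp (by simp [hk])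
  have s1 : ⟪ψ₁, ψ₁⟫ = 1 := by simp [inner_self_eq_norm_sq_to_K, hψ₁]
  have t1 : ⟪χ₁, χ₁⟫ = 1 := by simp [inner_self_eq_norm_sq_to_K, hχ₁]
  have e13 := orth o13 h₁ h₃
  have e23 := orth o23 h₂ h₃
  obtain ⟨k, hk, rfl⟩ : ∃ k : ℂ, ‖k‖ = 1 ∧ χ₂ = k • χ₁ := by
    refine (dep hψ₁ hψ₂ hχ₁ hχ₂ h₁ h₂).resolve_left ?_
    rintro ⟨k, hk, rfl⟩
    rw [inner_smul_right, s1, mul_one] at hperp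
    exact ne_zero hk hperp
  obtain ⟨c, hc, rfl⟩ : ∃ c : ℂ, ‖c‖ = 1 ∧ χ₃ = c • χ₁ := by
    refine (dep hψ₁ hψ₃ hχ₁ hχ₃ h₁ h₃).resolve_left ?_
    rintro ⟨l, hl, rfl⟩
    rw [inner_smul_right, s1, mul_one] at e13
    have hχ : ⟪χ₁, χ₃⟫ = 0 := (mul_eq_zero.mp e13).resolve_left (ne_zero hl)
    rcases dep hψ₂ hψ₃ hχ₂ hχ₃ h₂ h₃ with ⟨m, hm, hψ⟩ | ⟨m, hm, rfl⟩
    · have h0 : ⟪ψ₁, l • ψ₁⟫ = 0 := by rw [hψ, inner_smul_right, hperp, mul_zero]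
      rw [inner_smul_right, s1, mul_one] at h0
      exact ne_zero hl h0
    · rw [inner_smul_right, inner_smul_right, t1, mul_one] at hχ
      exact mul_ne_zero (ne_zero hm) (ne_zero hk) hχ
  have hne : ⟪k • χ₁, c • χ₁⟫ ≠ 0 := by
    rw [inner_smul_left, inner_smul_right, t1, mul_one]
    exact mul_ne_zero ((map_ne_zero _).mpr (ne_zero hk)) (ne_zero hc)
  exact ⟨⟨(mul_eq_zero.mp e23).resolve_right hne, c, hc, rfl⟩, hne⟩
end
end

section
/- Let H₁ and H₂ be complex separable Hilbert spaces whose Hilbert dimensions (cardinalities of orthonormal bases) are not equal, and let U : H₁ ⊗ H₂ → H₁ ⊗ H₂ be a unitary map sending every product vector to a product vector. Then U is of product form: there exist unitary maps V : H₁ → H₁ and W : H₂ → H₂ with U(φ ⊗ ϕ) = (Vφ) ⊗ (Wϕ) for all φ ∈ H₁, ϕ ∈ H₂. Equivalently, the swap-type alternative U(φ ⊗ ϕ) = (V₂₁ϕ) ⊗ (W₁₂φ) with surjective isometries V₂₁ : H₂ → H₁, W₁₂ : H₁ → H₂ can only occur if H₁ and H₂ have equal Hilbert dimensions. -/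
open scoped ComplexInnerProductSpace

noncomputable section

namespace IsHilbertTensorProduct

variable {H₁ H₂ T : Type*}
  [NormedAddCommGroup H₁] [InnerProductSpace ℂ H₁]
  [NormedAddCommGroup H₂] [InnerProductSpace ℂ H₂]
  [NormedAddCommGroup T] [InnerProductSpace ℂ T]
  {tmul : H₁ →ₗ[ℂ] H₂ →ₗ[ℂ] T}

theorem flip (h : IsHilbertTensorProduct H₁ H₂ T tmul) :
    IsHilbertTensorProduct H₂ H₁ T tmul.flip where
  inner_tmul a c b d := by
    rw [LinearMap.flip_apply, LinearMap.flip_apply, h.inner_tmul, mul_comm]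
  dense_span := by
    have : (Set.range fun p : H₂ × H₁ => tmul.flip p.1 p.2) =
        Set.range fun p : H₁ × H₂ => tmul p.1 p.2 := by
      ext t
      constructor <;> rintro ⟨⟨a, b⟩, rfl⟩ <;> exact ⟨(b, a), rfl⟩
    rw [this]
    exact h.dense_span

theorem compr₂ (h : IsHilbertTensorProduct H₁ H₂ T tmul) (U : T ≃ₗᵢ[ℂ] T) :
    IsHilbertTensorProduct H₁ H₂ T (tmul.compr₂ U.toLinearEquiv.toLinearMap) where
  inner_tmul a c b d := by
    simpa using h.inner_tmul a c b d
  dense_span := by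
    have : (Set.range fun p : H₁ × H₂ => tmul.compr₂ U.toLinearEquiv.toLinearMap p.1 p.2) =
        U.toLinearEquiv.toLinearMap '' Set.range fun p : H₁ × H₂ => tmul p.1 p.2 := by
      rw [← Set.range_comp]
      rfl
    rw [this, ← Submodule.map_span, Submodule.map_coe]
    exact U.surjective.denseRange.dense_image U.continuous h.dense_span

theorem norm_tmul (h : IsHilbertTensorProduct H₁ H₂ T tmul) (a : H₁) (b : H₂) :
    ‖tmul a b‖ = ‖a‖ * ‖b‖ := by
  have h1 := h.inner_tmul a a b b
  simp only [inner_self_eq_norm_sq_to_K] at h1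
  have h2 : ‖tmul a b‖ ^ 2 = (‖a‖ * ‖b‖) ^ 2 := by
    rw [mul_pow]
    exact_mod_cast h1
  exact (pow_left_inj₀ (norm_nonneg _) (by positivity) two_ne_zero).1 h2

theorem tmul_ne_zero (h : IsHilbertTensorProduct H₁ H₂ T tmul) {a : H₁} {b : H₂}
    (ha : a ≠ 0) (hb : b ≠ 0) : tmul a b ≠ 0 := by
  rw [← norm_ne_zero_iff, h.norm_tmul]
  exact mul_ne_zero (norm_ne_zero_iff.2 ha) (norm_ne_zero_iff.2 hb)

theorem eq_zero_of_inner_tmul (h : IsHilbertTensorProduct H₁ H₂ T tmul) {t : T}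
    (ht : ∀ a b, ⟪tmul a b, t⟫ = 0) : t = 0 := by
  refine h.dense_span.eq_zero_of_inner_right (𝕜 := ℂ) fun v hv => ?_
  induction hv using Submodule.span_induction with
  | mem x hx => obtain ⟨p, rfl⟩ := hx; exact ht _ _
  | zero => exact inner_zero_left _
  | add x y _ _ hx hy => rw [inner_add_left, hx, hy, add_zero]
  | smul c x _ hx => rw [inner_smul_left, hx, mul_zero]

/-- Contraction of an identity between simple tensors against a vector of the second factor. -/
theorem contract_right (h : IsHilbertTensorProduct H₁ H₂ T tmul) {a a' x : H₁} {b b' y : H₂}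
    (e : tmul a b + tmul a' b' = tmul x y) (w : H₂) :
    ⟪w, b⟫ • a + ⟪w, b'⟫ • a' = ⟪w, y⟫ • x := by
  refine ext_inner_left ℂ fun v => ?_
  have := congrArg (fun t => ⟪tmul v w, t⟫) e
  simp only [inner_add_right, h.inner_tmul] at this
  simp only [inner_add_right, inner_smul_right]
  linear_combination this

theorem left_mem_span (h : IsHilbertTensorProduct H₁ H₂ T tmul) {a x : H₁} {b y : H₂}
    (hb : b ≠ 0) (e : tmul a b = tmul x y) : ∃ c : ℂ, a = c • x := by
  have := h.contract_right (a' := 0) (b' := 0) (by simpa using e) b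
  simp only [smul_zero, add_zero] at this
  refine ⟨⟪b, b⟫⁻¹ * ⟪b, y⟫, ?_⟩
  rw [mul_smul, ← this, inv_smul_smul₀ (inner_self_ne_zero.2 hb)]

theorem exists_smul_of_orthogonal {b b' : H₂}
    (hb : ∀ w : H₂, ⟪w, b'⟫ = 0 → ⟪w, b⟫ = 0) : ∃ c : ℂ, b = c • b' := by
  have : b ∈ (ℂ ∙ b')ᗮᗮ := by
    rw [Submodule.mem_orthogonal]
    intro w hw
    exact hb w (Submodule.inner_left_of_mem_orthogonal (Submodule.mem_span_singleton_self b') hw)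
  rw [Submodule.orthogonal_orthogonal] at this
  obtain ⟨c, hc⟩ := Submodule.mem_span_singleton.1 this
  exact ⟨c, hc.symm⟩

/-- If a sum of two simple tensors is simple, the left factors or the right factors are
proportional. -/
theorem proportional_of_add (h : IsHilbertTensorProduct H₁ H₂ T tmul) {a a' x : H₁} {b b' y : H₂}
    (e : tmul a b + tmul a' b' = tmul x y) :
    (∃ (u : H₁) (c d : ℂ), a = c • u ∧ a' = d • u) ∨
      ∃ (v : H₂) (c d : ℂ), b = c • v ∧ b' = d • v := by
  by_cases h1 : ∀ w : H₂, ⟪w, b'⟫ = 0 → ⟪w, b⟫ = 0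
  · obtain ⟨c, hc⟩ := exists_smul_of_orthogonal h1
    exact Or.inr ⟨b', c, 1, hc, (one_smul _ _).symm⟩
  by_cases h2 : ∀ w : H₂, ⟪w, b⟫ = 0 → ⟪w, b'⟫ = 0
  · obtain ⟨c, hc⟩ := exists_smul_of_orthogonal h2
    exact Or.inr ⟨b, 1, c, (one_smul _ _).symm, hc⟩
  push Not at h1 h2
  obtain ⟨w, hw, hw'⟩ := h1
  obtain ⟨z, hz, hz'⟩ := h2
  have e1 := h.contract_right e w
  have e2 := h.contract_right e z
  rw [hw, zero_smul, add_zero] at e1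
  rw [hz, zero_smul, zero_add] at e2
  refine Or.inl ⟨x, ⟪w, b⟫⁻¹ * ⟪w, y⟫, ⟪z, b'⟫⁻¹ * ⟪z, y⟫, ?_, ?_⟩
  · rw [mul_smul, ← e1, inv_smul_smul₀ hw']
  · rw [mul_smul, ← e2, inv_smul_smul₀ hz']

end IsHilbertTensorProduct

/-- All values of `L` are simple tensors with one common left factor. -/
def HasCommonLeft {H₁ H₂ T E : Type*}
    [NormedAddCommGroup H₁] [InnerProductSpace ℂ H₁]
    [NormedAddCommGroup H₂] [InnerProductSpace ℂ H₂]
    [NormedAddCommGroup T] [InnerProductSpace ℂ T]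
    [NormedAddCommGroup E] [InnerProductSpace ℂ E]
    (tmul : H₁ →ₗ[ℂ] H₂ →ₗ[ℂ] T) (L : E →ₗ[ℂ] T) : Prop :=
  ∃ x, ∀ e, ∃ y, L e = tmul x y

namespace IsHilbertTensorProduct

variable {H₁ H₂ T E : Type*}
  [NormedAddCommGroup H₁] [InnerProductSpace ℂ H₁]
  [NormedAddCommGroup H₂] [InnerProductSpace ℂ H₂]
  [NormedAddCommGroup T] [InnerProductSpace ℂ T]
  [NormedAddCommGroup E] [InnerProductSpace ℂ E]
  {tmul M : H₁ →ₗ[ℂ] H₂ →ₗ[ℂ] T}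

/-- A linear space of simple tensors has a common left factor or a common right factor. -/
theorem hasCommonLeft_or (h : IsHilbertTensorProduct H₁ H₂ T tmul) (L : E →ₗ[ℂ] T)
    (hL : ∀ e, ∃ x y, L e = tmul x y) :
    HasCommonLeft tmul L ∨ HasCommonLeft tmul.flip L := by
  by_contra! hcon
  obtain ⟨hl, hr⟩ := hcon
  simp only [HasCommonLeft, not_exists, not_forall, LinearMap.flip_apply] at hl hr
  obtain ⟨e₁, he₁⟩ := hl 0
  obtain ⟨x₁, y₁, h₁⟩ := hL e₁
  have hx₁ : x₁ ≠ 0 := by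
    rintro rfl
    exact he₁ 0 (by simpa using h₁)
  have hy₁ : y₁ ≠ 0 := by
    rintro rfl
    exact he₁ 0 (by simpa using h₁)
  obtain ⟨e₂, he₂⟩ := hl x₁
  obtain ⟨e₃, he₃⟩ := hr y₁
  have not_left : ∀ {e x y}, L e = tmul x y → (∀ y', L e ≠ tmul x₁ y') →
      ∀ (u : H₁) (c d : ℂ), x₁ = c • u → x = d • u → False := by
    intro e x y he hne u c d hc hd
    have hc0 : c ≠ 0 := by
      rintro rfl
      exact hx₁ (by simpa using hc)
    apply hne ((d * c⁻¹) • y)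
    rw [he, hd, hc]
    simp only [map_smul, LinearMap.smul_apply, smul_smul]
    congr 1
    field_simp
  have not_right : ∀ {e x y}, L e = tmul x y → (∀ x', L e ≠ tmul x' y₁) →
      ∀ (u : H₂) (c d : ℂ), y₁ = c • u → y = d • u → False := by
    intro e x y he hne u c d hc hd
    have hc0 : c ≠ 0 := by
      rintro rfl
      exact hy₁ (by simpa using hc)
    apply hne ((d * c⁻¹) • x)
    rw [he, hd, hc]
    simp only [map_smul, LinearMap.smul_apply, smul_smul]
    congr 1
    field_simp
  obtain ⟨x₂, y₂, h₂⟩ := hL e₂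
  obtain ⟨x₃, y₃, h₃⟩ := hL e₃
  obtain ⟨x, y, hxy⟩ := hL (e₁ + e₂)
  rw [map_add, h₁, h₂] at hxy
  obtain ⟨u, c, d, hc, hd⟩ | ⟨v, c, d, hc, hd⟩ := h.proportional_of_add hxy
  · exact not_left h₂ he₂ u c d hc hd
  obtain ⟨x', y', hxy'⟩ := hL (e₁ + e₃)
  rw [map_add, h₁, h₃] at hxy'
  obtain ⟨u, c', d', hc', hd'⟩ | ⟨v', c', d', hc', hd'⟩ := h.proportional_of_add hxy'
  swap
  · exact not_right h₃ he₃ v' c' d' hc' hd'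
  have hy₂ : y₂ ≠ 0 := by
    rintro rfl
    exact he₂ 0 (by simpa using h₂)
  have hx₃ : x₃ ≠ 0 := by
    rintro rfl
    exact he₃ 0 (by simpa using h₃)
  have hd0 : d ≠ 0 := by
    rintro rfl
    exact hy₂ (by simpa using hd)
  have hd0' : d' ≠ 0 := by
    rintro rfl
    exact hx₃ (by simpa using hd')
  obtain ⟨p, q, hpq⟩ := hL (e₂ + e₃)
  rw [map_add, h₂, h₃] at hpq
  obtain ⟨r, s, t, hs, ht⟩ | ⟨r, s, t, hs, ht⟩ := h.proportional_of_add hpq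
  · refine not_left h₂ he₂ r (c' * d'⁻¹ * t) s ?_ hs
    rw [hc', mul_smul, ← ht, hd', smul_smul]
    congr 1
    field_simp
  · refine not_right h₃ he₃ r (c * d⁻¹ * s) t ?_ ht
    rw [hc, mul_smul, ← hs, hd, smul_smul]
    congr 1
    field_simp

/-- An isometry into simple tensors with a common left factor yields an isometry into the
second factor. -/
theorem exists_linearIsometry (h : IsHilbertTensorProduct H₁ H₂ T tmul) (L : E →ₗ[ℂ] T)
    {k : ℝ} (hk : 0 < k) (hnorm : ∀ e, ‖L e‖ = k * ‖e‖) {x : H₁} (hx : ‖x‖ = k)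
    (hL : ∀ e, ∃ y, L e = tmul x y) :
    ∃ W : E →ₗᵢ[ℂ] H₂, ∀ e, L e = tmul x (W e) := by
  have hx0 : x ≠ 0 := norm_ne_zero_iff.1 (hx ▸ hk.ne')
  have hinj : LinearMap.ker (tmul x) = ⊥ := by
    rw [LinearMap.ker_eq_bot']
    intro y hy
    by_contra hy0
    exact h.tmul_ne_zero hx0 hy0 hy
  obtain ⟨g, hg⟩ := (tmul x).exists_leftInverse_of_injective hinj
  have key : ∀ e, L e = tmul x (g (L e)) := by
    intro e
    obtain ⟨y, hy⟩ := hL e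
    rw [hy]
    congr 1
    exact (LinearMap.congr_fun hg y).symm
  refine ⟨⟨g ∘ₗ L, fun e => ?_⟩, key⟩
  have := hnorm e
  rw [key e, h.norm_tmul, hx] at this
  exact mul_left_cancel₀ hk.ne' this

theorem _root_.HasCommonLeft.exists_norm_eq {L : E →ₗ[ℂ] T} (hL : HasCommonLeft tmul L)
    {k : ℝ} (hk : 0 < k) (hne : ∃ e, L e ≠ 0) :
    ∃ x, ‖x‖ = k ∧ ∀ e, ∃ y, L e = tmul x y := by
  obtain ⟨x, hx⟩ := hL
  have hx0 : x ≠ 0 := by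
    rintro rfl
    obtain ⟨e, he⟩ := hne
    obtain ⟨y, hy⟩ := hx e
    exact he (by simpa using hy)
  have hn : (‖x‖ : ℂ) ≠ 0 := by exact_mod_cast norm_ne_zero_iff.2 hx0
  refine ⟨((k / ‖x‖ : ℝ) : ℂ) • x, ?_, fun e => ?_⟩
  · rw [norm_smul, Complex.norm_real, Real.norm_of_nonneg (by positivity)]
    field_simp
  · obtain ⟨y, hy⟩ := hx e
    refine ⟨((‖x‖ / k : ℝ) : ℂ) • y, ?_⟩
    have hk' : (k : ℂ) ≠ 0 := by exact_mod_cast hk.ne'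
    rw [hy]
    simp only [map_smul, LinearMap.smul_apply, smul_smul]
    push_cast
    rw [show (‖x‖ / k * (k / ‖x‖) : ℂ) = 1 by field_simp, one_smul]

/-- If every row `M φ` has a common left factor, then every column has a common right factor. -/
theorem columns_of_rows [Nontrivial H₂] (h : IsHilbertTensorProduct H₁ H₂ T tmul)
    (hM : IsHilbertTensorProduct H₁ H₂ T M) (hs : ∀ φ ϕ, ∃ x y, M φ ϕ = tmul x y)
    (hrow : ∀ φ, HasCommonLeft tmul (M φ)) (ϕ : H₂) :
    HasCommonLeft tmul.flip (M.flip ϕ) := by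
  obtain ⟨x₀, hx₀⟩ | hr := h.hasCommonLeft_or (M.flip ϕ) fun φ => hs φ ϕ
  swap
  · exact hr
  rcases eq_or_ne ϕ 0 with rfl | hϕ
  · exact ⟨0, fun φ => ⟨0, by simp⟩⟩
  have hall : ∀ φ ψ, ∃ y, M φ ψ = tmul x₀ y := by
    intro φ ψ
    rcases eq_or_ne φ 0 with rfl | hφ
    · exact ⟨0, by simp⟩
    obtain ⟨x, hx⟩ := hrow φ
    obtain ⟨y, hy⟩ := hx ϕ
    obtain ⟨y₀, hy₀⟩ := hx₀ φ
    have hne := hM.tmul_ne_zero hφ hϕ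
    have hy0 : y ≠ 0 := by
      rintro rfl
      exact hne (by simpa using hy)
    obtain ⟨c, rfl⟩ := h.left_mem_span hy0 (hy.symm.trans hy₀)
    obtain ⟨z, hz⟩ := hx ψ
    exact ⟨c • z, by simpa using hz⟩
  obtain ⟨w, hw⟩ := exists_ne (0 : H₂)
  have hspan : ∀ z : H₁, ∃ c : ℂ, z = c • x₀ := by
    refine fun z => exists_smul_of_orthogonal fun v hv => ?_
    have : tmul v w = 0 := hM.eq_zero_of_inner_tmul fun a b => by
      obtain ⟨y, hy⟩ := hall a b
      rw [hy, h.inner_tmul, ← inner_conj_symm, hv, map_zero, zero_mul]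
    have hv0 : v = 0 := by
      by_contra hv0
      exact h.tmul_ne_zero hv0 hw this
    rw [hv0, inner_zero_left]
  obtain ⟨p, q, hpq⟩ := hs x₀ ϕ
  refine ⟨q, fun φ => ?_⟩
  obtain ⟨c, rfl⟩ := hspan φ
  exact ⟨c • p, by simp [hpq]⟩

/-- A linear isometry whose image tensored with the second factor covers `T` is surjective. -/
theorem surjective_left [CompleteSpace H₁] [Nontrivial H₂]
    (h : IsHilbertTensorProduct H₁ H₂ T tmul)
    (hM : IsHilbertTensorProduct H₁ H₂ T M) (V : H₁ →ₗᵢ[ℂ] H₁) (W : H₂ → H₂)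
    (hVW : ∀ φ ϕ, M φ ϕ = tmul (V φ) (W ϕ)) : Function.Surjective V := by
  obtain ⟨w, hw⟩ := exists_ne (0 : H₂)
  have hclosed : IsClosed ((LinearMap.range V.toLinearMap : Submodule ℂ H₁) : Set H₁) := by
    exact V.isometry.isClosedEmbedding.isClosed_range
  have : CompleteSpace (LinearMap.range V.toLinearMap) := hclosed.completeSpace_coe
  rw [← LinearIsometry.coe_toLinearMap, ← LinearMap.range_eq_top,
    ← Submodule.orthogonal_eq_bot_iff, Submodule.eq_bot_iff]
  intro z hz
  have hzw : tmul z w = 0 := hM.eq_zero_of_inner_tmul fun a b => by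
    have hVa : ⟪V a, z⟫ = 0 :=
      Submodule.inner_right_of_mem_orthogonal (LinearMap.mem_range_self V.toLinearMap a) hz
    rw [hVW, h.inner_tmul, hVa, zero_mul]
  by_contra hz0
  exact h.tmul_ne_zero hz0 hw hzw

/-- If rows have a common left factor and columns a common right factor, then `M` is of product
form. -/
theorem exists_product_form [CompleteSpace H₁] [CompleteSpace H₂] [Nontrivial H₁] [Nontrivial H₂]
    (h : IsHilbertTensorProduct H₁ H₂ T tmul) (hM : IsHilbertTensorProduct H₁ H₂ T M)
    (hrow : ∀ φ, HasCommonLeft tmul (M φ)) (hcol : ∀ ϕ, HasCommonLeft tmul.flip (M.flip ϕ)) :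
    ∃ (V : H₁ ≃ₗᵢ[ℂ] H₁) (W : H₂ ≃ₗᵢ[ℂ] H₂), ∀ φ ϕ, M φ ϕ = tmul (V φ) (W ϕ) := by
  obtain ⟨φ₀, hφ₀⟩ := exists_norm_eq (E := H₁) (zero_le_one' ℝ)
  obtain ⟨ϕ₀, hϕ₀⟩ := exists_norm_eq (E := H₂) (zero_le_one' ℝ)
  have hφ0 : φ₀ ≠ 0 := norm_ne_zero_iff.1 (by rw [hφ₀]; exact one_ne_zero)
  have hϕ0 : ϕ₀ ≠ 0 := norm_ne_zero_iff.1 (by rw [hϕ₀]; exact one_ne_zero)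
  obtain ⟨x₀, hx₀, hx⟩ := (hrow φ₀).exists_norm_eq one_pos
    ⟨ϕ₀, hM.tmul_ne_zero hφ0 hϕ0⟩
  obtain ⟨W, hW⟩ := h.exists_linearIsometry (M φ₀) one_pos
    (fun e => by rw [hM.norm_tmul, hφ₀]) hx₀ hx
  have hy₀ : ‖W ϕ₀‖ = 1 := by rw [W.norm_map, hϕ₀]
  have hy : ∀ φ, ∃ x, M.flip ϕ₀ φ = tmul.flip (W ϕ₀) x := by
    obtain ⟨y, hy⟩ := hcol ϕ₀
    obtain ⟨x, hx'⟩ := hy φ₀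
    have hy0 : y ≠ 0 := by
      rintro rfl
      exact hM.tmul_ne_zero hφ0 hϕ0 (by simpa using hx')
    have hx0 : x ≠ 0 := by
      rintro rfl
      exact hM.tmul_ne_zero hφ0 hϕ0 (by simpa using hx')
    obtain ⟨c, hc⟩ := h.flip.left_mem_span (x := W ϕ₀) (y := x₀) hx0
      (hx'.symm.trans (by simpa using hW ϕ₀))
    intro φ
    obtain ⟨z, hz⟩ := hy φ
    exact ⟨c • z, by rw [hz, hc]; simp⟩
  obtain ⟨V, hV⟩ := h.flip.exists_linearIsometry (M.flip ϕ₀) one_pos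
    (fun e => by rw [LinearMap.flip_apply, hM.norm_tmul, hϕ₀, mul_comm]) hy₀ hy
  simp only [LinearMap.flip_apply] at hV
  have hmul : ∀ φ ϕ, ∃ c : ℂ, M φ ϕ = c • tmul (V φ) (W ϕ) := by
    intro φ ϕ
    rcases eq_or_ne φ 0 with rfl | hφ
    · exact ⟨0, by simp⟩
    rcases eq_or_ne ϕ 0 with rfl | hϕ
    · exact ⟨0, by simp⟩
    obtain ⟨x, hx⟩ := hrow φ
    obtain ⟨y, hy⟩ := hcol ϕ
    simp only [LinearMap.flip_apply] at hy
    obtain ⟨q, hq⟩ := hx ϕ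
    obtain ⟨q₀, hq₀⟩ := hx ϕ₀
    obtain ⟨p₀, hp₀⟩ := hy φ₀
    have hq0 : q ≠ 0 := by
      rintro rfl
      exact hM.tmul_ne_zero hφ hϕ (by simpa using hq)
    have hx0 : x ≠ 0 := by
      rintro rfl
      exact hM.tmul_ne_zero hφ hϕ (by simpa using hq)
    have hq₀0 : q₀ ≠ 0 := by
      rintro rfl
      exact hM.tmul_ne_zero hφ hϕ0 (by simpa using hq₀)
    have hp₀0 : p₀ ≠ 0 := by
      rintro rfl
      exact hM.tmul_ne_zero hφ0 hϕ (by simpa using hp₀)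
    obtain ⟨c, hc⟩ := h.left_mem_span hq₀0 (hq₀.symm.trans (hV φ))
    obtain ⟨p, hp⟩ := hy φ
    obtain ⟨d, hd⟩ := h.flip.left_mem_span hx0 (hq.symm.trans hp)
    obtain ⟨d', hd'⟩ := h.flip.left_mem_span hp₀0 (hp₀.symm.trans (hW ϕ))
    refine ⟨c * d * d', ?_⟩
    rw [hq, hc, hd, hd']
    simp only [map_smul, LinearMap.smul_apply, smul_smul]
    congr 1
    ring
  have hgen : ∀ φ ϕ, ⟪φ₀, φ⟫ ≠ 0 → ⟪ϕ₀, ϕ⟫ ≠ 0 → M φ ϕ = tmul (V φ) (W ϕ) := by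
    intro φ ϕ hφ hϕ
    obtain ⟨c, hc⟩ := hmul φ ϕ
    have := hM.inner_tmul φ₀ φ ϕ₀ ϕ
    rw [hc, hV φ₀, inner_smul_right, h.inner_tmul, V.inner_map_map, W.inner_map_map] at this
    rw [hc, mul_eq_right₀ (mul_ne_zero hφ hϕ) |>.1 this, one_smul]
  have hin₁ : ⟪φ₀, φ₀⟫ ≠ 0 := inner_self_ne_zero.2 hφ0
  have hin₂ : ⟪ϕ₀, ϕ₀⟫ ≠ 0 := inner_self_ne_zero.2 hϕ0
  have hleft : ∀ φ ϕ, ⟪ϕ₀, ϕ⟫ ≠ 0 → M φ ϕ = tmul (V φ) (W ϕ) := by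
    intro φ ϕ hϕ
    by_cases hφ : ⟪φ₀, φ⟫ = 0
    · have h1 := hgen (φ + φ₀) ϕ (by rwa [inner_add_right, hφ, zero_add]) hϕ
      have h2 := hgen φ₀ ϕ hin₁ hϕ
      simp only [map_add, LinearMap.add_apply] at h1
      rwa [h2, add_left_inj] at h1
    · exact hgen φ ϕ hφ hϕ
  have hall : ∀ φ ϕ, M φ ϕ = tmul (V φ) (W ϕ) := by
    intro φ ϕ
    by_cases hϕ : ⟪ϕ₀, ϕ⟫ = 0
    · have h1 := hleft φ (ϕ + ϕ₀) (by rwa [inner_add_right, hϕ, zero_add])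
      have h2 := hleft φ ϕ₀ hin₂
      simp only [map_add] at h1
      rwa [h2, add_left_inj] at h1
    · exact hleft φ ϕ hϕ
  exact ⟨LinearIsometryEquiv.ofSurjective V (h.surjective_left hM V W hall),
    LinearIsometryEquiv.ofSurjective W
      (h.flip.surjective_left hM.flip W V fun ϕ φ => hall φ ϕ), hall⟩

/-- A nonzero column with a common left factor embeds the first space into the second one. -/
theorem nonempty_linearIsometry_of_hasCommonLeft_flip
    {H : Type*} [NormedAddCommGroup H] [InnerProductSpace ℂ H]
    [Nontrivial E] (h : IsHilbertTensorProduct H₁ H₂ T tmul)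
    {N : E →ₗ[ℂ] H →ₗ[ℂ] T} (hN : IsHilbertTensorProduct E H T N) {b : H} (hb : b ≠ 0)
    (hL : HasCommonLeft tmul (N.flip b)) : Nonempty (E →ₗᵢ[ℂ] H₂) := by
  obtain ⟨e, he⟩ := exists_ne (0 : E)
  have hpos := norm_pos_iff.2 hb
  obtain ⟨x, hx, hx'⟩ := hL.exists_norm_eq hpos ⟨e, hN.tmul_ne_zero he hb⟩
  obtain ⟨W, -⟩ := h.exists_linearIsometry (N.flip b) hpos
    (fun e => by rw [LinearMap.flip_apply, hN.norm_tmul, mul_comm]) hx hx'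
  exact ⟨W⟩

end IsHilbertTensorProduct

theorem Orthonormal.countable {ι H : Type*} [NormedAddCommGroup H] [InnerProductSpace ℂ H]
    [TopologicalSpace.SeparableSpace H] {v : ι → H} (hv : Orthonormal ℂ v) : Countable ι := by
  have hdist : ∀ i j, i ≠ j → 1 < dist (v i) (v j) := by
    intro i j hij
    have h0 : ⟪v i, v j⟫ = 0 := hv.2 hij
    have h1 : ‖v i - v j‖ * ‖v i - v j‖ = ‖v i‖ * ‖v i‖ + ‖v j‖ * ‖v j‖ := by
      rw [sub_eq_add_neg, norm_add_sq_eq_norm_sq_add_norm_sq_of_inner_eq_zero (𝕜 := ℂ) _ _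
        (by rw [inner_neg_right, h0, neg_zero]), norm_neg]
    rw [hv.1 i, hv.1 j] at h1
    rw [dist_eq_norm]
    nlinarith [norm_nonneg (v i - v j)]
  have hd : Pairwise (Function.onFun Disjoint fun i => Metric.ball (v i) (1 / 2)) := by
    intro i j hij
    exact Metric.ball_disjoint_ball (by linarith [hdist i j hij])
  exact hd.countable_of_isOpen_disjoint (fun i => Metric.isOpen_ball)
    fun i => Metric.nonempty_ball.2 (by norm_num)

theorem HilbertBasis.finite_and_card {ι H : Type*} [NormedAddCommGroup H] [InnerProductSpace ℂ H]
    [FiniteDimensional ℂ H] (b : HilbertBasis ι ℂ H) :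
    Finite ι ∧ Nat.card ι = Module.finrank ℂ H := by
  have hfin : Finite ι := b.orthonormal.linearIndependent.finite
  have := Fintype.ofFinite ι
  refine ⟨hfin, ?_⟩
  rw [Module.finrank_eq_card_basis b.toOrthonormalBasis.toBasis, Nat.card_eq_fintype_card]

theorem HilbertBasis.infinite {ι H : Type*} [NormedAddCommGroup H] [InnerProductSpace ℂ H]
    [CompleteSpace H] (hH : ¬ FiniteDimensional ℂ H) (b : HilbertBasis ι ℂ H) : Infinite ι := by
  by_contra hfin
  rw [not_infinite_iff_finite] at hfin
  have := Fintype.ofFinite ι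
  exact hH b.toOrthonormalBasis.toBasis.finiteDimensional_of_finite

/-- Separable Hilbert spaces that embed isometrically into each other have equal Hilbert
dimension. -/
theorem HilbertBasis.nonempty_equiv {ι₁ ι₂ H₁ H₂ : Type*}
    [NormedAddCommGroup H₁] [InnerProductSpace ℂ H₁] [CompleteSpace H₁]
    [TopologicalSpace.SeparableSpace H₁]
    [NormedAddCommGroup H₂] [InnerProductSpace ℂ H₂] [CompleteSpace H₂]
    [TopologicalSpace.SeparableSpace H₂]
    (b₁ : HilbertBasis ι₁ ℂ H₁) (b₂ : HilbertBasis ι₂ ℂ H₂)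
    (A : H₁ →ₗᵢ[ℂ] H₂) (B : H₂ →ₗᵢ[ℂ] H₁) : Nonempty (ι₁ ≃ ι₂) := by
  by_cases hfin : FiniteDimensional ℂ H₁
  · have : FiniteDimensional ℂ H₂ := FiniteDimensional.of_injective B.toLinearMap B.injective
    obtain ⟨f₁, c₁⟩ := b₁.finite_and_card
    obtain ⟨f₂, c₂⟩ := b₂.finite_and_card
    refine (Finite.card_eq).1 ?_
    rw [c₁, c₂]
    exact le_antisymm (LinearMap.finrank_le_finrank_of_injective (f := A.toLinearMap) A.injective)
      (LinearMap.finrank_le_finrank_of_injective (f := B.toLinearMap) B.injective)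
  · have hfin₂ : ¬ FiniteDimensional ℂ H₂ := fun _ =>
      hfin (FiniteDimensional.of_injective A.toLinearMap A.injective)
    have := b₁.infinite hfin
    have := b₂.infinite hfin₂
    have := b₁.orthonormal.countable
    have := b₂.orthonormal.countable
    exact nonempty_equiv_of_countable

/-- If the Hilbert dimensions of `H₁` and `H₂` (cardinalities of orthonormal
bases) differ, then every non-entangling unitary on `H₁ ⊗ H₂` is of product
form `U(φ ⊗ ϕ) = (Vφ) ⊗ (Wϕ)`; the swap-type alternative only occurs for
spaces of equal Hilbert dimension. -/
theorem nonentangling_unitary_product_form_of_dim_ne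
    {H₁ H₂ T : Type*}
    [NormedAddCommGroup H₁] [InnerProductSpace ℂ H₁] [CompleteSpace H₁]
    [TopologicalSpace.SeparableSpace H₁]
    [NormedAddCommGroup H₂] [InnerProductSpace ℂ H₂] [CompleteSpace H₂]
    [TopologicalSpace.SeparableSpace H₂]
    [NormedAddCommGroup T] [InnerProductSpace ℂ T] [CompleteSpace T]
    {ι₁ ι₂ : Type*}
    (b₁ : HilbertBasis ι₁ ℂ H₁) (b₂ : HilbertBasis ι₂ ℂ H₂)
    (hdim : ¬ Nonempty (ι₁ ≃ ι₂))
    (tmul : H₁ →ₗ[ℂ] H₂ →ₗ[ℂ] T)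
    (htp : IsHilbertTensorProduct H₁ H₂ T tmul)
    (U : T ≃ₗᵢ[ℂ] T)
    (hU : ∀ (φ : H₁) (ϕ : H₂), ∃ (x : H₁) (y : H₂), U (tmul φ ϕ) = tmul x y) :
    ∃ (V : H₁ ≃ₗᵢ[ℂ] H₁) (W : H₂ ≃ₗᵢ[ℂ] H₂),
      ∀ (φ : H₁) (ϕ : H₂), U (tmul φ ϕ) = tmul (V φ) (W ϕ) := by
  rcases subsingleton_or_nontrivial H₁ with hs₁ | hn₁
  · refine ⟨.refl ℂ H₁, .refl ℂ H₂, fun φ ϕ => ?_⟩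
    simp [Subsingleton.elim φ 0]
  rcases subsingleton_or_nontrivial H₂ with hs₂ | hn₂
  · refine ⟨.refl ℂ H₁, .refl ℂ H₂, fun φ ϕ => ?_⟩
    simp [Subsingleton.elim ϕ 0]
  have hM := htp.compr₂ U
  set M := tmul.compr₂ U.toLinearEquiv.toLinearMap
  have hs : ∀ φ ϕ, ∃ x y, M φ ϕ = tmul x y := hU
  have hside : (∀ φ, HasCommonLeft tmul (M φ)) ∨ ∀ ϕ, HasCommonLeft tmul.flip (M.flip ϕ) := by
    by_contra! hcon
    obtain ⟨⟨φ, hφ⟩, ϕ, hϕ⟩ := hcon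
    have hφ' := (htp.hasCommonLeft_or (M φ) (hs φ)).resolve_left hφ
    have hϕ' := (htp.hasCommonLeft_or (M.flip ϕ) fun φ => hs φ ϕ).resolve_right hϕ
    have hφ0 : φ ≠ 0 := by
      rintro rfl
      exact hφ ⟨0, fun e => ⟨0, by simp⟩⟩
    have hϕ0 : ϕ ≠ 0 := by
      rintro rfl
      exact hϕ ⟨0, fun e => ⟨0, by simp⟩⟩
    obtain ⟨A⟩ := htp.nonempty_linearIsometry_of_hasCommonLeft_flip hM hϕ0 hϕ'
    obtain ⟨B⟩ := htp.flip.nonempty_linearIsometry_of_hasCommonLeft_flip hM.flip hφ0 hφ'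
    exact hdim (b₁.nonempty_equiv b₂ A B)
  obtain hrow | hcol := hside
  · exact htp.exists_product_form hM hrow (htp.columns_of_rows hM hs hrow)
  · exact htp.exists_product_form hM
      (htp.flip.columns_of_rows hM.flip (fun ϕ φ => exists_comm.1 (hs φ ϕ)) hcol) hcol
end
end

section
/- Let H be a complex Hilbert space of dimension at least 2. There is no sequence (Vₙ)ₙ, (Wₙ)ₙ of unitary operators on H such that for all x, y ∈ H the vectors (Vₙx) ⊗ (Wₙy) converge in norm in H ⊗ H to y ⊗ x. Consequently, if (U_t) for t ∈ [0, τ] is a family of unitaries on H ⊗ H, continuous in the strong operator topology, with each U_t for t < τ of product form U_t = V_t ⊗ W_t for unitaries V_t, W_t on H, then U_τ cannot equal the swap map x ⊗ y ↦ y ⊗ x. -/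
open scoped ComplexInnerProductSpace

noncomputable section

open Filter Topology

/-- In dimension at least two, there are two nonzero orthogonal vectors. -/
theorem exists_ne_zero_inner_eq_zero_of_two_le_rank {H : Type*}
    [NormedAddCommGroup H] [InnerProductSpace ℂ H] (hrank : 2 ≤ Module.rank ℂ H) :
    ∃ e f : H, e ≠ 0 ∧ f ≠ 0 ∧ ⟪e, f⟫ = 0 := by
  have hone : 1 < Module.rank ℂ H := lt_of_lt_of_le (by norm_num) hrank
  have : Nontrivial H := rank_pos_iff_nontrivial.mp (zero_lt_one.trans hone)
  obtain ⟨e, he⟩ := exists_ne (0 : H)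
  have hne : (ℂ ∙ e)ᗮ ≠ ⊥ := by
    rw [Ne, Submodule.orthogonal_eq_bot_iff]
    intro htop
    have hle := rank_span_le (R := ℂ) ({e} : Set H)
    rw [htop, rank_top, Cardinal.mk_singleton] at hle
    exact hone.not_ge hle
  obtain ⟨f, hf, hf0⟩ := Submodule.exists_mem_ne_zero_of_ne_bot hne
  exact ⟨e, f, he, hf0, Submodule.mem_orthogonal_singleton_iff_inner_right.mp hf⟩

/-- In dimension at least two, no family of maps `x ⊗ y ↦ V x ⊗ W y` converges pointwise to the
swap map along a nontrivial filter; linearity of `V` and `W` plays no role. -/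
theorem IsHilbertTensorProduct.not_tendsto_swap {H T ι : Type*}
    [NormedAddCommGroup H] [InnerProductSpace ℂ H]
    [NormedAddCommGroup T] [InnerProductSpace ℂ T]
    {tmul : H →ₗ[ℂ] H →ₗ[ℂ] T} (htp : IsHilbertTensorProduct H H T tmul)
    (hrank : 2 ≤ Module.rank ℂ H) {l : Filter ι} [l.NeBot] (V W : ι → H → H) :
    ¬ ∀ x y : H, Tendsto (fun i => tmul (V i x) (W i y)) l (𝓝 (tmul y x)) := by
  intro h
  obtain ⟨e, f, he, hf, hef⟩ := exists_ne_zero_inner_eq_zero_of_two_le_rank hrank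
  have key : ∀ a b x y : H,
      Tendsto (fun i => ⟪a, V i x⟫ * ⟪b, W i y⟫) l (𝓝 (⟪a, y⟫ * ⟪b, x⟫)) := by
    intro a b x y
    simpa only [htp.inner_tmul] using tendsto_const_nhds.inner (𝕜 := ℂ) (x := tmul a b) (h x y)
  have hdiag := (key e e e e).mul (key f e e f)
  have hcross := (key f e e e).mul (key e e e f)
  have heq := tendsto_nhds_unique hdiag (hcross.congr fun i => by ring)
  simp [hef, he, hf] at heq

/-- For `dim H ≥ 2`, no sequence of product unitaries `Vₙ ⊗ Wₙ` can converge
pointwise (on product vectors, in norm) to the swap map `x ⊗ y ↦ y ⊗ x`.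
Consequently, a strongly continuous family `(U_t)_{t ∈ [0,τ]}` of unitaries on
`H ⊗ H` which is of product form `V_t ⊗ W_t` for all `t < τ` cannot have
`U_τ` equal to the swap map. -/
theorem no_product_unitaries_converge_to_swap
    {H T : Type*}
    [NormedAddCommGroup H] [InnerProductSpace ℂ H] [CompleteSpace H]
    [NormedAddCommGroup T] [InnerProductSpace ℂ T] [CompleteSpace T]
    (hrank : 2 ≤ Module.rank ℂ H)
    (tmul : H →ₗ[ℂ] H →ₗ[ℂ] T)
    (htp : IsHilbertTensorProduct H H T tmul) :
    (¬ ∃ V W : ℕ → (H ≃ₗᵢ[ℂ] H), ∀ x y : H,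
        Filter.Tendsto (fun n => tmul (V n x) (W n y)) Filter.atTop
          (nhds (tmul y x))) ∧
    (∀ (τ : ℝ), 0 < τ → ∀ U : ℝ → (T ≃ₗᵢ[ℂ] T),
        (∀ v : T, ContinuousOn (fun t => U t v) (Set.Icc 0 τ)) →
        (∀ t ∈ Set.Ico (0 : ℝ) τ, ∃ (V W : H ≃ₗᵢ[ℂ] H),
          ∀ x y : H, U t (tmul x y) = tmul (V x) (W y)) →
        ¬ (∀ x y : H, U τ (tmul x y) = tmul y x)) := by
  refine ⟨fun ⟨V, W, h⟩ => htp.not_tendsto_swap hrank (fun n => V n) (fun n => W n) h, ?_⟩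
  intro τ hτ U hU hprod hswap
  choose! V W hVW using hprod
  have : (𝓝[Set.Ico 0 τ] τ).NeBot := by
    rw [← mem_closure_iff_nhdsWithin_neBot, closure_Ico hτ.ne]
    exact Set.right_mem_Icc.mpr hτ.le
  refine htp.not_tendsto_swap hrank (l := 𝓝[Set.Ico 0 τ] τ) (fun t => V t) (fun t => W t) ?_
  intro x y
  have hlim := ((hU (tmul x y)) τ (Set.right_mem_Icc.mpr hτ.le)).mono Set.Ico_subset_Icc_self
  rw [ContinuousWithinAt, hswap] at hlim
  exact hlim.congr' (eventually_mem_nhdsWithin.mono fun t ht => hVW t ht x y)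
end
end

section
/- Let n ≥ 2, let Φ : Matrix n n ℂ → Matrix n n ℂ be a linear map, and let E be an n × n complex matrix. Suppose that for every positive semidefinite matrix ρ with trace 1 one has Φ(ρ) = (tr(Eρ)) • ρ, i.e., the operation Φ leaves every state unchanged up to the normalization factor tr(Eρ). Then E is a scalar multiple of the identity: E = (tr(E)/n) • I. (No information gain without state disturbance: if the state transformer of a measurement leaves all object states unchanged, the measured effect is trivial.) -/
open scoped ComplexOrder

noncomputable section

/-- A linear map that scales every state by its outcome probability assigns the same outcome
probability to all states. -/
lemma trace_mul_eq_of_no_disturbance {m : Type*} [Fintype m]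
    (Φ : Matrix m m ℂ →ₗ[ℂ] Matrix m m ℂ) (E : Matrix m m ℂ)
    (hΦ : ∀ ρ : Matrix m m ℂ, ρ.PosSemidef → ρ.trace = 1 → Φ ρ = (E * ρ).trace • ρ)
    {ρ σ : Matrix m m ℂ} (hρ : ρ.PosSemidef) (hρ1 : ρ.trace = 1)
    (hσ : σ.PosSemidef) (hσ1 : σ.trace = 1) :
    (E * ρ).trace = (E * σ).trace := by
  have half_nonneg : (0 : ℂ) ≤ 1 / 2 := by positivity
  have hmid := hΦ ((1 / 2 : ℂ) • (ρ + σ)) ((hρ.add hσ).smul half_nonneg)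
    (by rw [Matrix.trace_smul, Matrix.trace_add, hρ1, hσ1]; norm_num)
  rw [map_smul, map_add, hΦ ρ hρ hρ1, hΦ σ hσ hσ1, Matrix.mul_smul, Matrix.mul_add,
    Matrix.trace_smul, Matrix.trace_add] at hmid
  by_contra hne
  refine hne (congrArg (fun τ => (E * τ).trace) ?_)
  ext i j
  have hij := congrFun (congrFun hmid i) j
  simp only [Matrix.smul_apply, Matrix.add_apply, smul_eq_mul] at hij
  refine mul_left_cancel₀ (sub_ne_zero.mpr hne) ?_
  linear_combination 4 * hij

/-- A complex matrix whose quadratic form vanishes is zero. -/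
lemma eq_zero_of_dotProduct_mulVec_self_eq_zero {m : Type*} [Fintype m] [DecidableEq m]
    {A : Matrix m m ℂ} (hA : ∀ v : m → ℂ, star v ⬝ᵥ A.mulVec v = 0) : A = 0 := by
  refine (Matrix.toEuclideanLin (𝕜 := ℂ)).map_eq_zero_iff.mp
    ((inner_map_self_eq_zero _).mp fun x => ?_)
  rw [← inner_conj_symm, EuclideanSpace.inner_eq_star_dotProduct, dotProduct_comm]
  simpa [Matrix.toLpLin_apply] using hA x.ofLp

/-- No information gain without state disturbance: if a linear operation `Φ` on
`n × n` complex matrices (`n ≥ 2`) satisfies `Φ(ρ) = tr(Eρ) • ρ` for every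
state `ρ` (positive semidefinite with trace 1), then the effect `E` is trivial,
i.e. the scalar multiple `(tr E / n) • I` of the identity. -/
theorem no_information_gain_without_disturbance
    (n : ℕ) (hn : 2 ≤ n)
    (Φ : Matrix (Fin n) (Fin n) ℂ →ₗ[ℂ] Matrix (Fin n) (Fin n) ℂ)
    (E : Matrix (Fin n) (Fin n) ℂ)
    (hΦ : ∀ ρ : Matrix (Fin n) (Fin n) ℂ, ρ.PosSemidef → ρ.trace = 1 →
      Φ ρ = (E * ρ).trace • ρ) :
    E = (E.trace / n) • (1 : Matrix (Fin n) (Fin n) ℂ) := by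
  have : NeZero n := ⟨by omega⟩
  have hn0 : (n : ℂ) ≠ 0 := NeZero.ne _
  let ρ₀ : Matrix (Fin n) (Fin n) ℂ := Matrix.vecMulVec (Pi.single 0 1) (star (Pi.single 0 1))
  have hρ₀ : ρ₀.PosSemidef := Matrix.posSemidef_vecMulVec_self_star _
  have hρ₀1 : ρ₀.trace = 1 := by simp [ρ₀, Matrix.trace_vecMulVec]
  have hE : E - (E * ρ₀).trace • (1 : Matrix (Fin n) (Fin n) ℂ) = 0 := by
    refine eq_zero_of_dotProduct_mulVec_self_eq_zero fun v => ?_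
    rcases eq_or_ne v 0 with rfl | hv
    · simp
    have hpos : 0 < v ⬝ᵥ star v := by
      rw [dotProduct_comm]
      exact Matrix.dotProduct_star_self_pos_iff.mpr hv
    have h := trace_mul_eq_of_no_disturbance Φ E hΦ
      ((Matrix.posSemidef_vecMulVec_self_star v).smul (inv_nonneg.mpr hpos.le))
      (by rw [Matrix.trace_smul, Matrix.trace_vecMulVec, smul_eq_mul, inv_mul_cancel₀ hpos.ne'])
      hρ₀ hρ₀1
    rw [Matrix.mul_smul, Matrix.trace_smul, Matrix.mul_vecMulVec, Matrix.trace_vecMulVec,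
      smul_eq_mul, inv_mul_eq_iff_eq_mul₀ hpos.ne'] at h
    rw [Matrix.sub_mulVec, Matrix.smul_mulVec, Matrix.one_mulVec, dotProduct_sub,
      dotProduct_smul, smul_eq_mul, dotProduct_comm, h, dotProduct_comm (star v)]
    ring
  have hc := sub_eq_zero.mp hE
  have ht : E.trace / n = (E * ρ₀).trace := by
    rw [div_eq_iff hn0]
    simpa using congrArg Matrix.trace hc
  rw [ht]
  exact hc
end
end

section
/- Let H be a complex Hilbert space of dimension at least 2 and let Φ be a linear map on the space of bounded linear operators on H. Suppose that for every unit vector φ ∈ H there is a scalar c(φ) ∈ ℂ such that Φ(P_φ) = c(φ) • P_φ, where P_φ is the rank-one orthogonal projection onto the span of φ. Then c(φ) takes the same value for all unit vectors φ; i.e., there is a single scalar c with Φ(P_φ) = c • P_φ for every unit vector φ. -/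
open scoped ComplexInnerProductSpace

noncomputable section

/-- The rank-one orthogonal projection `P_φ : x ↦ ⟪φ, x⟫ φ` onto the span of a
(unit) vector `φ` of a complex Hilbert space. -/
def rankOneProjection {H : Type*} [NormedAddCommGroup H]
    [InnerProductSpace ℂ H] (φ : H) : H →L[ℂ] H :=
  (innerSL ℂ φ).smulRight φ

section

variable {H : Type*} [NormedAddCommGroup H] [InnerProductSpace ℂ H]

@[simp]
theorem rankOneProjection_apply (x z : H) : rankOneProjection x z = inner ℂ x z • x := rfl

theorem rankOneProjection_smul (a : ℂ) (x : H) :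
    rankOneProjection (a • x) = (starRingEnd ℂ a * a) • rankOneProjection x := by
  ext z
  simp only [rankOneProjection_apply, inner_smul_left, smul_apply, smul_smul]
  congr 1
  ring

theorem rankOneProjection_add_add_sub (x y : H) :
    rankOneProjection (x + y) + rankOneProjection (x - y) =
      (2 : ℂ) • (rankOneProjection x + rankOneProjection y) := by
  ext z
  simp only [rankOneProjection_apply, inner_add_left, inner_sub_left,
    add_apply, smul_apply]
  module

/-- A linear map acting on the projections onto unit vectors by scalars acts by a scalar on
`rankOneProjection x` for every vector `x`. -/
theorem exists_map_rankOneProjection_eq_smul {Φ : (H →L[ℂ] H) →ₗ[ℂ] (H →L[ℂ] H)}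
    (hΦ : ∀ φ : H, ‖φ‖ = 1 → ∃ c : ℂ, Φ (rankOneProjection φ) = c • rankOneProjection φ)
    (x : H) : ∃ c : ℂ, Φ (rankOneProjection x) = c • rankOneProjection x := by
  rcases eq_or_ne x 0 with rfl | hx
  · have h0 : rankOneProjection (0 : H) = 0 := by ext; simp
    exact ⟨0, by simp [h0]⟩
  · obtain ⟨c, hc⟩ := hΦ ((‖x‖⁻¹ : ℂ) • x) (norm_smul_inv_norm hx)
    have hx' : (‖x‖ : ℂ) ≠ 0 := by simpa using hx
    have h : x = (‖x‖ : ℂ) • ((‖x‖⁻¹ : ℂ) • x) := (smul_inv_smul₀ hx' x).symm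
    refine ⟨c, ?_⟩
    rw [h, rankOneProjection_smul, map_smul, hc, smul_comm]

/-- A combination of the operators `z ↦ ⟪x, z⟫ x`, `z ↦ ⟪y, z⟫ x`, `z ↦ ⟪x, z⟫ y`, `z ↦ ⟪y, z⟫ y`
with equal mixed coefficients vanishes only if its diagonal coefficients do, when `x` and `y` are
linearly independent. -/
theorem eq_zero_of_rankOne_combination {x y : H} (h : LinearIndependent ℂ ![x, y]) {p q r : ℂ}
    (hz : ∀ z : H, (p * inner ℂ x z + q * inner ℂ y z) • x +
      (q * inner ℂ x z + r * inner ℂ y z) • y = 0) : p = 0 ∧ r = 0 := by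
  rw [LinearIndependent.pair_iff] at h
  have key (s t : ℂ) (hst : ∀ z : H, s * inner ℂ x z + t * inner ℂ y z = 0) : s = 0 ∧ t = 0 := by
    have h0 : starRingEnd ℂ s • x + starRingEnd ℂ t • y = 0 := by
      refine ext_inner_right ℂ fun z ↦ ?_
      simpa [inner_add_left, inner_smul_left] using hst z
    simpa using h _ _ h0
  exact ⟨(key p q fun z ↦ (h _ _ (hz z)).1).1, (key q r fun z ↦ (h _ _ (hz z)).2).2⟩

theorem scalar_eq_of_linearIndependent {Φ : (H →L[ℂ] H) →ₗ[ℂ] (H →L[ℂ] H)}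
    (hΦ : ∀ φ : H, ‖φ‖ = 1 → ∃ c : ℂ, Φ (rankOneProjection φ) = c • rankOneProjection φ)
    {x y : H} (h : LinearIndependent ℂ ![x, y]) {c d : ℂ}
    (hc : Φ (rankOneProjection x) = c • rankOneProjection x)
    (hd : Φ (rankOneProjection y) = d • rankOneProjection y) : c = d := by
  obtain ⟨a, ha⟩ := exists_map_rankOneProjection_eq_smul hΦ (x + y)
  obtain ⟨b, hb⟩ := exists_map_rankOneProjection_eq_smul hΦ (x - y)
  have hsum := congrArg Φ (rankOneProjection_add_add_sub x y)
  rw [map_add, map_smul, map_add, ha, hb, hc, hd] at hsum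
  obtain ⟨h₁, h₂⟩ := eq_zero_of_rankOne_combination h
    (p := a + b - 2 * c) (q := a - b) (r := a + b - 2 * d) fun z ↦ by
      have hz := DFunLike.congr_fun hsum z
      simp only [rankOneProjection_apply, inner_add_left, inner_sub_left,
        add_apply, smul_apply] at hz
      rw [← sub_eq_zero] at hz
      rw [← hz]
      module
  linear_combination (h₂ - h₁) / 2

end

/-- If a linear map `Φ` on the bounded operators of a complex Hilbert space `H`
with `dim H ≥ 2` satisfies `Φ(P_φ) = c(φ) • P_φ` for every unit vector `φ`,
then the scalar `c(φ)` is the same for all unit vectors `φ`. -/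
theorem scalar_independent_of_state
    {H : Type*} [NormedAddCommGroup H] [InnerProductSpace ℂ H]
    [CompleteSpace H]
    (hrank : 2 ≤ Module.rank ℂ H)
    (Φ : (H →L[ℂ] H) →ₗ[ℂ] (H →L[ℂ] H))
    (hΦ : ∀ φ : H, ‖φ‖ = 1 → ∃ c : ℂ,
      Φ (rankOneProjection φ) = c • rankOneProjection φ) :
    ∃ c : ℂ, ∀ φ : H, ‖φ‖ = 1 →
      Φ (rankOneProjection φ) = c • rankOneProjection φ := by
  by_cases hne : ∃ φ : H, ‖φ‖ = 1
  · obtain ⟨φ, hφ⟩ := hne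
    obtain ⟨c, hc⟩ := hΦ φ hφ
    refine ⟨c, fun ψ hψ ↦ ?_⟩
    by_cases h : LinearIndependent ℂ ![φ, ψ]
    · obtain ⟨d, hd⟩ := hΦ ψ hψ
      rw [hd, scalar_eq_of_linearIndependent hΦ h hc hd]
    · have hφ0 : φ ≠ 0 := by
        rintro rfl
        simp at hφ
      rw [LinearIndependent.pair_iff' hφ0] at h
      push Not at h
      obtain ⟨a, rfl⟩ := h
      rw [rankOneProjection_smul, map_smul, hc, smul_comm]
  · exact ⟨0, fun φ hφ ↦ absurd ⟨φ, hφ⟩ hne⟩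
end
end
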